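/- Let A = [[0,1,0,1],[1,0,1,0],[0,1,0,1],[1,0,1,0]] and J = [[0,0,1,0],[0,0,0,1],[1,0,0,0],[0,1,0,0]] be 4×4 zero-one matrices and I the 4×4 identity matrix, so that (A, J) and (A, I) are flip pairs. Then for every positive integer m: p_{2m-1,0}(σ_A, φ_{J,A}) = 0, p_{2m,0}(σ_A, φ_{J,A}) = 0, and p_{2m,1}(σ_A, φ_{J,A}) = 0; while p_{2m-1,0}(σ_A, φ_{I,A}) = 0, p_{2m,0}(σ_A, φ_{I,A}) = 2^{m+2}, and p_{2m,1}(σ_A, φ_{I,A}) = 0. -/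

import Mathlib

open Matrix

/-- A zero-one integer matrix. -/
def IsZeroOne {α β : Type*} (M : Matrix α β ℤ) : Prop := ∀ a b, M a b = 0 ∨ M a b = 1

/-- A flip pair: a pair `(A, J)` of zero-one square matrices with `AJ = JAᵀ` and `J² = I`. -/
def IsFlipPair {α : Type*} [Fintype α] [DecidableEq α] (A J : Matrix α α ℤ) : Prop :=
  IsZeroOne A ∧ IsZeroOne J ∧ A * J = J * Aᵀ ∧ J * J = 1

/-- The topological Markov chain `X_A` determined by `A`, as a subtype of `ℤ → α`
(which carries the product topology when `α` is a topological space). -/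
abbrev SFT {α : Type*} (A : Matrix α α ℤ) :=
  {x : ℤ → α // ∀ i : ℤ, A (x i) (x (i + 1)) = 1}

/-- The shift map `σ_A` on `X_A`, as a bijection: `σ_A(x)_i = x_{i+1}`. -/
def shiftEquiv {α : Type*} (A : Matrix α α ℤ) : Equiv.Perm (SFT A) where
  toFun x := ⟨fun i => x.1 (i + 1), fun i => x.2 (i + 1)⟩
  invFun x := ⟨fun i => x.1 (i - 1), fun i => by
    have h := x.2 (i - 1); rwa [show i - 1 + 1 = i + 1 - 1 by ring] at h⟩
  left_inv x := Subtype.ext (funext fun i => by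
    show x.1 (i - 1 + 1) = x.1 i
    norm_num)
  right_inv x := Subtype.ext (funext fun i => by
    show x.1 (i + 1 - 1) = x.1 i
    norm_num)

/-- `pFix T m = p_m(T)`: the number of points fixed by `T^m`. -/
noncomputable def pFix {X : Type*} (T : Equiv.Perm X) (m : ℕ) : ℕ :=
  Nat.card {x : X // (T ^ m) x = x}

/-- `pFlip T φ m n = p_{m,n}(T, φ)`: the number of points fixed by both `T^m` and `T^n ∘ φ`. -/
noncomputable def pFlip {X : Type*} (T : Equiv.Perm X) (φ : X → X) (m : ℕ) (n : ℤ) : ℕ :=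
  Nat.card {x : X // (T ^ m) x = x ∧ (T ^ n) (φ x) = x}

theorem shiftEquiv_pow_apply {α : Type*} (A : Matrix α α ℤ) (n : ℕ) (x : SFT A) (i : ℤ) :
    ((shiftEquiv A ^ n) x).1 i = x.1 (i + n) := by
  induction n generalizing i with
  | zero => simp
  | succ n ih =>
    rw [pow_succ', Equiv.Perm.mul_apply]
    change ((shiftEquiv A ^ n) x).1 (i + 1) = _
    rw [ih]
    rw [Nat.cast_succ, add_right_comm, add_assoc]

/-- The adjacency matrix of the 4-cycle, in which two states are adjacent exactly when their
parities differ. -/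
abbrev fourCycle : Matrix (Fin 4) (Fin 4) ℤ := !![0,1,0,1; 1,0,1,0; 0,1,0,1; 1,0,1,0]

theorem fourCycle_eq_one_iff (a b : Fin 4) :
    fourCycle a b = 1 ↔ (a.val + b.val) % 2 = 1 := by
  fin_cases a <;> fin_cases b <;> simp [fourCycle]

theorem fourCycle_parity (x : SFT fourCycle) (i : ℤ) :
    ((x.1 i).val : ℤ) % 2 = ((x.1 0).val + i) % 2 := by
  induction i using Int.induction_on with
  | zero => simp
  | succ i ih =>
    have h := (fourCycle_eq_one_iff _ _).1 (x.2 i)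
    omega
  | pred i ih =>
    have h := (fourCycle_eq_one_iff _ _).1 (x.2 (-i - 1))
    rw [sub_add_cancel] at h
    omega

theorem pFlip_eq_zero {X : Type*} {T : Equiv.Perm X} {φ : X → X} {m : ℕ} {n : ℤ}
    (h : ∀ x, (T ^ m) x = x → (T ^ n) (φ x) = x → False) : pFlip T φ m n = 0 :=
  have : IsEmpty {x : X // (T ^ m) x = x ∧ (T ^ n) (φ x) = x} := ⟨fun x => h x.1 x.2.1 x.2.2⟩
  Nat.card_of_isEmpty

/-- The representative in `{0, …, m}` of the orbit of `i` under `i ↦ -i` and `i ↦ i + 2m`. -/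
def dihedralFold (m : ℕ) (i : ℤ) : Fin (m + 1) :=
  Fin.ofNat (m + 1) (min (i % (2 * m)) (-i % (2 * m))).toNat

theorem dihedralFold_neg (m : ℕ) (i : ℤ) : dihedralFold m (-i) = dihedralFold m i := by
  simp [dihedralFold, min_comm]

theorem dihedralFold_add (m : ℕ) (i : ℤ) : dihedralFold m (i + 2 * m) = dihedralFold m i := by
  have h : (-(i + 2 * m)) % (2 * m : ℤ) = -i % (2 * m) := by
    rw [show -(i + 2 * m : ℤ) = -i - 2 * m by ring, Int.sub_emod_right]
  rw [dihedralFold, dihedralFold, h, Int.add_emod_right]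

theorem dihedralFold_val {m : ℕ} (hm : 1 ≤ m) (i : ℤ) :
    ((dihedralFold m i).val : ℤ) = min (i % (2 * m)) (-i % (2 * m)) := by
  have h₁ := Int.emod_nonneg i (b := 2 * m) (by omega)
  have h₂ := Int.emod_nonneg (-i) (b := 2 * m) (by omega)
  have h₃ : min (i % (2 * m)) (-i % (2 * m)) ≤ m := by
    have h₄ : (-i) % (2 * m : ℤ) = (-(i % (2 * m))) % (2 * m) :=
      ((Int.mod_modEq i (2 * m)).neg).symm
    by_contra! h
    have h₅ := Int.emod_lt_of_pos i (b := 2 * m) (by omega)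
    have h₆ : (-(i % (2 * m))) % (2 * m : ℤ) = 2 * m - i % (2 * m) := by
      rw [← Int.add_emod_right, Int.emod_eq_of_lt] <;> omega
    omega
  simp only [dihedralFold, Fin.ofNat]
  rw [Nat.mod_eq_of_lt (by omega)]
  omega

theorem dihedralFold_natCast {m : ℕ} (hm : 1 ≤ m) (j : Fin (m + 1)) :
    dihedralFold m (j.val : ℤ) = j := by
  have hj := j.isLt
  have h := dihedralFold_val hm (j.val : ℤ)
  rw [Int.emod_eq_of_lt (by omega) (by omega)] at h
  apply Fin.ext
  rcases Nat.eq_zero_or_pos j.val with h₀ | h₀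
  · rw [h₀] at h ⊢
    simp at h
    simp [h]
  · rw [← Int.add_emod_right, Int.emod_eq_of_lt (by omega) (by omega)] at h
    omega

theorem apply_dihedralFold {α : Type*} {m : ℕ} (hm : 1 ≤ m) {x : ℤ → α}
    (hper : Function.Periodic x (2 * m)) (hsymm : ∀ i, x (-i) = x i) (i : ℤ) :
    x (dihedralFold m i).val = x i := by
  have h (k : ℤ) : x (k % (2 * m)) = x k := by
    rw [Int.emod_def, mul_comm]
    exact hper.sub_int_mul_eq (k / (2 * m))
  rw [dihedralFold_val hm]
  rcases min_choice (i % (2 * m : ℤ)) (-i % (2 * m)) with h' | h' <;> rw [h', h]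
  exact hsymm i

/-- The point of the 4-cycle shift fixed by the dihedral action that starts with parity `d.1`
and whose states in positions `0, …, m` have upper bits `d.2`. -/
def symmetricPoint (m : ℕ) (d : Fin 2 × (Fin (m + 1) → Fin 2)) : SFT fourCycle where
  val i := ⟨2 * (d.2 (dihedralFold m i)).val + ((d.1.val + i) % 2).toNat, by omega⟩
  property i := by
    rw [fourCycle_eq_one_iff]
    dsimp only
    omega

theorem symmetricPoint_val (m : ℕ) (d : Fin 2 × (Fin (m + 1) → Fin 2)) (i : ℤ) :
    (((symmetricPoint m d).1 i).val : ℤ) =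
      2 * (d.2 (dihedralFold m i)).val + (d.1.val + i) % 2 := by
  simp only [symmetricPoint]
  omega

theorem card_symmetric_fourCycle {m : ℕ} (hm : 1 ≤ m) :
    Nat.card {x : SFT fourCycle // Function.Periodic x.1 (2 * m) ∧ ∀ i, x.1 (-i) = x.1 i} =
      2 ^ (m + 2) := by
  have hsym (d) : Function.Periodic (symmetricPoint m d).1 (2 * m) ∧
      ∀ i, (symmetricPoint m d).1 (-i) = (symmetricPoint m d).1 i := by
    constructor <;> intro i <;> apply Fin.ext <;> zify <;> simp only [symmetricPoint_val]
    · rw [dihedralFold_add]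
      omega
    · rw [dihedralFold_neg]
      omega
  have hbij : Function.Bijective (fun d => (⟨symmetricPoint m d, hsym d⟩ :
      {x : SFT fourCycle // Function.Periodic x.1 (2 * m) ∧ ∀ i, x.1 (-i) = x.1 i})) := by
    constructor
    · intro d e h
      have h' (i : ℤ) : (((symmetricPoint m d).1 i).val : ℤ) = ((symmetricPoint m e).1 i).val := by
        exact congrArg (fun y => ((y.1.1 i).val : ℤ)) h
      simp only [symmetricPoint_val] at h'
      refine Prod.ext (Fin.ext ?_) (funext fun j => Fin.ext ?_)
      · have := h' 0
        omega
      · have := h' j.val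
        rw [dihedralFold_natCast hm] at this
        omega
    · rintro ⟨x, hper, hsymm⟩
      refine ⟨(⟨(x.1 0).val % 2, by omega⟩, fun j => ⟨(x.1 j.val).val / 2, by omega⟩), ?_⟩
      refine Subtype.ext (Subtype.ext (funext fun i => Fin.ext ?_))
      have h := symmetricPoint_val m
        (⟨(x.1 0).val % 2, by omega⟩, fun j => ⟨(x.1 j.val).val / 2, by omega⟩) i
      have hp := fourCycle_parity x i
      simp only [apply_dihedralFold hm hper hsymm] at h
      zify
      rw [h]
      push_cast
      omega
  rw [← Nat.card_eq_of_bijective _ hbij]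
  simp [pow_succ]
  ring

/-- For the given `4×4` flip pairs `(A, J)` and `(A, I)` and every positive
integer `m`: `p_{2m-1,0}(σ_A, φ_{J,A}) = p_{2m,0}(σ_A, φ_{J,A}) = p_{2m,1}(σ_A, φ_{J,A}) = 0`,
while `p_{2m-1,0}(σ_A, φ_{I,A}) = 0`, `p_{2m,0}(σ_A, φ_{I,A}) = 2^{m+2}`, and
`p_{2m,1}(σ_A, φ_{I,A}) = 0`. -/
theorem stmt15 (A J : Matrix (Fin 4) (Fin 4) ℤ)
    (hA : A = !![0,1,0,1; 1,0,1,0; 0,1,0,1; 1,0,1,0])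
    (hJ : J = !![0,0,1,0; 0,0,0,1; 1,0,0,0; 0,1,0,0])
    (τJ : Fin 4 → Fin 4) (hτJ : ∀ a b, J a b = 1 ↔ τJ a = b)
    (τI : Fin 4 → Fin 4) (hτI : ∀ a b, (1 : Matrix (Fin 4) (Fin 4) ℤ) a b = 1 ↔ τI a = b)
    (φJ : SFT A → SFT A) (hφJ : ∀ x i, (φJ x).1 i = τJ (x.1 (-i)))
    (φI : SFT A → SFT A) (hφI : ∀ x i, (φI x).1 i = τI (x.1 (-i)))
    (m : ℕ) (hm : 1 ≤ m) :
    pFlip (shiftEquiv A) φJ (2 * m - 1) 0 = 0 ∧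
    pFlip (shiftEquiv A) φJ (2 * m) 0 = 0 ∧
    pFlip (shiftEquiv A) φJ (2 * m) 1 = 0 ∧
    pFlip (shiftEquiv A) φI (2 * m - 1) 0 = 0 ∧
    pFlip (shiftEquiv A) φI (2 * m) 0 = 2 ^ (m + 2) ∧
    pFlip (shiftEquiv A) φI (2 * m) 1 = 0 := by
  subst hA hJ
  have hJ' (a) : τJ a = a + 2 := (hτJ a _).1 (by revert a; decide)
  have hI' (a) : τI a = a := (hτI a _).1 (by simp)
  have hodd (φ) : pFlip (shiftEquiv fourCycle) φ (2 * m - 1) 0 = 0 := by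
    refine pFlip_eq_zero fun x h _ => ?_
    have h' := shiftEquiv_pow_apply fourCycle (2 * m - 1) x 0
    rw [h] at h'
    have hp := fourCycle_parity x (0 + (2 * m - 1 : ℕ))
    rw [← h'] at hp
    omega
  have hone (φ : SFT fourCycle → SFT fourCycle)
      (hφ : ∀ x i, ((φ x).1 i).val % 2 = (x.1 (-i)).val % 2) :
      pFlip (shiftEquiv fourCycle) φ (2 * m) 1 = 0 := by
    refine pFlip_eq_zero fun x _ h => ?_
    have h' : (φ x).1 (0 + 1) = x.1 0 := congrFun (congrArg Subtype.val h) 0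
    have hp := fourCycle_parity x (-(0 + 1))
    have := hφ x (0 + 1)
    rw [h'] at this
    omega
  refine ⟨hodd _, pFlip_eq_zero fun x _ h => ?_, hone _ fun x i => ?_, hodd _, ?_,
    hone _ fun x i => ?_⟩
  · have h' : (φJ x).1 0 = x.1 0 := congrFun (congrArg Subtype.val h) 0
    rw [hφJ, hJ', neg_zero] at h'
    generalize x.1 0 = a at h'
    revert a
    decide
  · rw [hφJ, hJ']
    generalize x.1 (-i) = a
    revert a
    decide
  · rw [← card_symmetric_fourCycle hm]
    refine Nat.card_congr (Equiv.subtypeEquivRight fun x => and_congr ?_ ?_)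
    · simp only [Subtype.ext_iff, funext_iff, shiftEquiv_pow_apply, Function.Periodic]
      push_cast
      rfl
    · simp only [zpow_zero, Equiv.Perm.one_apply, Subtype.ext_iff, funext_iff, hφI, hI']
  · rw [hφI, hI']
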